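/- arXiv:2603.03533 — 6 statements merged into one kernel-verified Lean document; each statement's English description precedes it below -/
import Mathlib

section
/- Let Pe > 0 and let n be a positive integer. Then the equation cos μ = −(Pe/2)·(sin μ)/μ has exactly one solution μ in the open interval I_n = ((n − 1/2)π, (n + 1/2)π). Equivalently, the function f(μ) = (2/Pe)·μ + tan μ is strictly increasing on I_n (away from the endpoints, where tan is defined) and has exactly one zero there. -/
open Real Set

/-- For Pe > 0 and a positive integer n, the eigenvalue equation
`cos μ = -(Pe/2)·(sin μ)/μ` has exactly one solution in
`I_n = ((n - 1/2)π, (n + 1/2)π)`; equivalently, `f(μ) = (2/Pe)·μ + tan μ`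
is strictly increasing on `I_n` and has exactly one zero there. -/
theorem eigenvalue_exists_unique_in_In (Pe : ℝ) (hPe : 0 < Pe) (n : ℕ) (hn : 1 ≤ n) :
    (∃! μ : ℝ, μ ∈ Ioo (((n : ℝ) - 1/2) * π) (((n : ℝ) + 1/2) * π) ∧
        Real.cos μ = -(Pe / 2) * (Real.sin μ / μ)) ∧
    StrictMonoOn (fun μ : ℝ => (2 / Pe) * μ + Real.tan μ)
        (Ioo (((n : ℝ) - 1/2) * π) (((n : ℝ) + 1/2) * π)) ∧
    (∃! μ : ℝ, μ ∈ Ioo (((n : ℝ) - 1/2) * π) (((n : ℝ) + 1/2) * π) ∧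
        (2 / Pe) * μ + Real.tan μ = 0) := by
  have hpi := Real.pi_pos
  have hn' : (1 : ℝ) ≤ n := by exact_mod_cast hn
  have hc : 0 < 2 / Pe := by positivity
  have hnpi : 0 < (n : ℝ) * π := by positivity
  have hmono : StrictMonoOn (fun μ : ℝ => (2 / Pe) * μ + Real.tan μ)
      (Ioo (((n : ℝ) - 1/2) * π) (((n : ℝ) + 1/2) * π)) := by
    intro x hx y hy hxy
    have h1 : Real.tan (x - n * π) < Real.tan (y - n * π) := by
      apply Real.strictMonoOn_tan
      · constructor <;> linarith [hx.1, hx.2]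
      · constructor <;> linarith [hy.1, hy.2]
      · linarith
    rw [Real.tan_sub_nat_mul_pi, Real.tan_sub_nat_mul_pi] at h1
    have h2 := mul_lt_mul_of_pos_left hxy hc
    show (2 / Pe) * x + Real.tan x < (2 / Pe) * y + Real.tan y
    linarith
  have hex : ∃! μ : ℝ, μ ∈ Ioo (((n : ℝ) - 1/2) * π) (((n : ℝ) + 1/2) * π) ∧
        (2 / Pe) * μ + Real.tan μ = 0 := by
    have hcont : Continuous (fun t : ℝ => (2 / Pe) * (n * π + Real.arctan t) + t) := by
      have := Real.continuous_arctan
      fun_prop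
    have hb : 0 < (2 / Pe) * (n * π) := mul_pos hc hnpi
    have hab : -((2 / Pe) * (n * π)) ≤ 0 := by linarith
    have hneg : Real.arctan (-((2 / Pe) * (n * π))) < 0 := by
      rw [Real.arctan_neg, neg_lt_zero]
      simpa using Real.arctan_strictMono hb
    obtain ⟨t, -, ht⟩ := intermediate_value_Icc hab hcont.continuousOn
      (show (0 : ℝ) ∈ Icc _ _ from by
        constructor
        · have := mul_neg_of_pos_of_neg hc hneg
          simp only [mul_add]
          linarith
        · simp only [Real.arctan_zero, add_zero]
          exact hb.le)
    have h0 : (2 / Pe) * (n * π + Real.arctan t) + t = 0 := ht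
    have htan : Real.tan (n * π + Real.arctan t) = t := by
      rw [add_comm, Real.tan_add_nat_mul_pi, Real.tan_arctan]
    have hmem : n * π + Real.arctan t ∈ Ioo (((n : ℝ) - 1/2) * π) (((n : ℝ) + 1/2) * π) := by
      have h1 := Real.neg_pi_div_two_lt_arctan t
      have h2 := Real.arctan_lt_pi_div_two t
      constructor <;> linarith
    refine ⟨n * π + Real.arctan t, ⟨hmem, by rw [htan]; exact h0⟩, ?_⟩
    rintro y ⟨hy, hy0⟩
    apply hmono.injOn hy hmem
    show (2 / Pe) * y + Real.tan y = (2 / Pe) * (n * π + Real.arctan t) + Real.tan _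
    rw [hy0, htan, h0]
  have hiff : ∀ μ ∈ Ioo (((n : ℝ) - 1/2) * π) (((n : ℝ) + 1/2) * π),
      (Real.cos μ = -(Pe / 2) * (Real.sin μ / μ) ↔ (2 / Pe) * μ + Real.tan μ = 0) := by
    intro μ hμ
    have hμ0 : μ ≠ 0 := by
      have : 0 < ((n : ℝ) - 1/2) * π := mul_pos (by linarith) hpi
      exact (this.trans hμ.1).ne'
    have hcos : Real.cos μ ≠ 0 := by
      have h : 0 < Real.cos (μ - n * π) :=
        Real.cos_pos_of_mem_Ioo (by constructor <;> linarith [hμ.1, hμ.2])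
      rw [Real.cos_sub_nat_mul_pi] at h
      exact right_ne_zero_of_mul h.ne'
    rw [Real.tan_eq_sin_div_cos]
    field_simp
    constructor <;> intro h <;> linarith
  refine ⟨?_, hmono, hex⟩
  obtain ⟨μ, ⟨hm, h0⟩, hu⟩ := hex
  exact ⟨μ, ⟨hm, (hiff μ hm).2 h0⟩, fun y hy => hu y ⟨hy.1, (hiff y hy.1).1 hy.2⟩⟩
end

section
/- Let Pe > 0 and let n be a positive integer. If μ ∈ I_n = ((n − 1/2)π, (n + 1/2)π) satisfies cos μ = −(Pe/2)·(sin μ)/μ, then in fact μ lies in the smaller interval ((n − 1/2)π, nπ), and moreover (−1)^{n+1}·sin μ > 0. -/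
open Real Set

/-- For Pe > 0 and a positive integer n, any solution of the eigenvalue equation
`cos μ = -(Pe/2)·(sin μ)/μ` in `I_n = ((n - 1/2)π, (n + 1/2)π)` in fact lies in
`((n - 1/2)π, nπ)`, and `(-1)^(n+1)·sin μ > 0`. -/
theorem eigenvalue_location_and_sign (Pe : ℝ) (hPe : 0 < Pe) (n : ℕ) (hn : 1 ≤ n) (μ : ℝ)
    (hμ : μ ∈ Ioo (((n : ℝ) - 1/2) * π) (((n : ℝ) + 1/2) * π))
    (heig : Real.cos μ = -(Pe / 2) * (Real.sin μ / μ)) :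
    μ ∈ Ioo (((n : ℝ) - 1/2) * π) ((n : ℝ) * π) ∧ 0 < (-1 : ℝ) ^ (n + 1) * Real.sin μ := by
  obtain ⟨h1, h2⟩ := hμ
  have hn' : (1 : ℝ) ≤ n := by exact_mod_cast hn
  have hπ := Real.pi_pos
  have hμ0 : 0 < μ := by nlinarith
  have hc : 0 < Real.cos (μ - n * π) :=
    Real.cos_pos_of_mem_Ioo ⟨by linarith, by linarith⟩
  have hs : Real.sin (μ - n * π) < 0 := by
    by_contra! h
    have e : Real.cos (μ - n * π) = -(Pe / 2) * (Real.sin (μ - n * π) / μ) := by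
      rw [Real.cos_sub_nat_mul_pi, Real.sin_sub_nat_mul_pi, heig]
      ring
    have : 0 ≤ (Pe / 2) * (Real.sin (μ - n * π) / μ) := by positivity
    linarith
  refine ⟨⟨h1, ?_⟩, ?_⟩
  · by_contra! h
    have := Real.sin_nonneg_of_nonneg_of_le_pi (x := μ - n * π) (by linarith) (by linarith)
    linarith
  · rw [Real.sin_sub_nat_mul_pi] at hs
    rw [pow_succ]
    linarith
end

section
/- Let Pe > 0 and let μ : ℕ → ℝ be a sequence such that for every positive integer n, μ_n lies in the interval ((n − 1/2)π, (n + 1/2)π) and satisfies cos μ_n = −(Pe/2)·(sin μ_n)/μ_n. Then μ_n − (n − 1/2)π tends to 0 as n → ∞; that is, the eigenvalues are asymptotic to μ_n^asymp = (n − 1/2)π. -/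
open Real Set Filter Topology

/-- If for every positive integer n, `μ n` lies in `((n - 1/2)π, (n + 1/2)π)` and solves the
eigenvalue equation `cos μ = -(Pe/2)·(sin μ)/μ`, then `μ n - (n - 1/2)π → 0` as `n → ∞`. -/
theorem eigenvalue_asymptotics (Pe : ℝ) (hPe : 0 < Pe) (μ : ℕ → ℝ)
    (hloc : ∀ n : ℕ, 1 ≤ n → μ n ∈ Ioo (((n : ℝ) - 1/2) * π) (((n : ℝ) + 1/2) * π))
    (heig : ∀ n : ℕ, 1 ≤ n → Real.cos (μ n) = -(Pe / 2) * (Real.sin (μ n) / μ n)) :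
    Tendsto (fun n : ℕ => μ n - ((n : ℝ) - 1/2) * π) atTop (𝓝 0) := by
  have key : ∀ n : ℕ, 1 ≤ n → 0 ≤ μ n - ((n : ℝ) - 1/2) * π ∧
      μ n - ((n : ℝ) - 1/2) * π ≤ (Pe / 2) / n := by
    intro n hn
    obtain ⟨h1, h2⟩ := hloc n hn
    have he := heig n hn
    have hn' : (1 : ℝ) ≤ n := by exact_mod_cast hn
    have hpi := Real.pi_pos
    set t := μ n - ((n : ℝ) - 1/2) * π with ht
    have ht0 : 0 < t := by linarith
    have htpi : t < π := by rw [ht]; linarith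
    have hμ : μ n = (t - π / 2) + n * π := by rw [ht]; ring
    have hm : (n : ℝ) / 2 * π ≤ μ n := by nlinarith
    have hmpos : 0 < μ n := lt_of_lt_of_le (by positivity) hm
    have hc : Real.cos (μ n) = (-1) ^ n * Real.sin t := by
      rw [hμ, Real.cos_add_nat_mul_pi, Real.cos_sub_pi_div_two]
    have hs : Real.sin (μ n) = -((-1) ^ n * Real.cos t) := by
      rw [hμ, Real.sin_add_nat_mul_pi, Real.sin_sub_pi_div_two]; ring
    rw [hc, hs] at he
    have hne : ((-1 : ℝ)) ^ n ≠ 0 := pow_ne_zero _ (by norm_num)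
    have he2 : Real.sin t = (Pe / 2) * (Real.cos t / μ n) := by
      apply mul_left_cancel₀ hne
      rw [he]; ring
    have hst : 0 < Real.sin t := Real.sin_pos_of_pos_of_lt_pi ht0 htpi
    have he3 : Real.sin t * μ n = (Pe / 2) * Real.cos t := by
      rw [he2]; field_simp
    have hcpos : 0 < Real.cos t := by
      have : 0 < Real.sin t * μ n := mul_pos hst hmpos
      rw [he3] at this
      exact (pos_iff_pos_of_mul_pos this).1 (by positivity)
    have hthalf : t ≤ π / 2 := by
      by_contra h
      push Not at h
      have := Real.cos_nonpos_of_pi_div_two_le_of_le h.le (by linarith)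
      linarith
    have hj := Real.mul_le_sin ht0.le hthalf
    have hle : Real.sin t * μ n ≤ Pe / 2 := by
      rw [he3]
      have := Real.cos_le_one t
      nlinarith
    refine ⟨ht0.le, ?_⟩
    rw [le_div_iff₀ (by linarith)]
    calc t * n = (2 / π * t) * ((n : ℝ) / 2 * π) := by field_simp
      _ ≤ Real.sin t * μ n := by gcongr
      _ ≤ Pe / 2 := hle
  refine squeeze_zero' ?_ ?_ (tendsto_const_div_atTop_nhds_zero_nat (Pe / 2))
  · filter_upwards [eventually_ge_atTop 1] with n hn using (key n hn).1
  · filter_upwards [eventually_ge_atTop 1] with n hn using (key n hn).2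
end

section
/- Let Pe > 0 and let μ, ν be distinct positive reals each satisfying the eigenvalue equation, i.e. cos μ = −(Pe/2)·(sin μ)/μ and cos ν = −(Pe/2)·(sin ν)/ν. Then the eigenfunctions are orthogonal on [0,1]: ∫₀¹ sin(μ(1 − ξ))·sin(ν(1 − ξ)) dξ = 0. -/
open Real Set

/-- Eigenfunctions corresponding to distinct eigenvalues are orthogonal on [0,1]. -/
theorem eigenfunctions_orthogonal (Pe μ ν : ℝ) (hPe : 0 < Pe) (hμ : 0 < μ) (hν : 0 < ν)
    (hne : μ ≠ ν)
    (heμ : Real.cos μ = -(Pe / 2) * (Real.sin μ / μ))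
    (heν : Real.cos ν = -(Pe / 2) * (Real.sin ν / ν)) :
    ∫ ξ in (0:ℝ)..1, Real.sin (μ * (1 - ξ)) * Real.sin (ν * (1 - ξ)) = 0 := by
  have hd : μ ^ 2 - ν ^ 2 ≠ 0 := by
    have h1 : μ - ν ≠ 0 := sub_ne_zero.mpr hne
    have h2 : μ + ν ≠ 0 := by positivity
    have h3 : μ ^ 2 - ν ^ 2 = (μ - ν) * (μ + ν) := by ring
    rw [h3]
    exact mul_ne_zero h1 h2
  have h1 : μ * Real.cos μ = -(Pe / 2) * Real.sin μ := by
    rw [heμ]; field_simp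
  have h2 : ν * Real.cos ν = -(Pe / 2) * Real.sin ν := by
    rw [heν]; field_simp
  have hder : ∀ x ∈ Set.uIcc (0:ℝ) 1, HasDerivAt
      (fun ξ : ℝ => (μ * (Real.cos (μ * (1 - ξ)) * Real.sin (ν * (1 - ξ)))
        - ν * (Real.sin (μ * (1 - ξ)) * Real.cos (ν * (1 - ξ)))) / (μ ^ 2 - ν ^ 2))
      (Real.sin (μ * (1 - x)) * Real.sin (ν * (1 - x))) x := by
    intro x _
    have hl : ∀ a : ℝ, HasDerivAt (fun ξ : ℝ => a * (1 - ξ)) (a * (-1)) x := fun a =>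
      ((hasDerivAt_id x).const_sub 1).const_mul a
    have h := ((((hl μ).cos.mul (hl ν).sin).const_mul μ).sub
      (((hl μ).sin.mul (hl ν).cos).const_mul ν)).div_const (μ ^ 2 - ν ^ 2)
    refine h.congr_deriv ?_
    rw [div_eq_iff hd]
    ring
  rw [intervalIntegral.integral_eq_sub_of_hasDerivAt hder
    ((by fun_prop : Continuous fun x : ℝ =>
      Real.sin (μ * (1 - x)) * Real.sin (ν * (1 - x))).intervalIntegrable 0 1)]
  have h3 : μ * (Real.cos μ * Real.sin ν) - ν * (Real.sin μ * Real.cos ν) = 0 := by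
    linear_combination Real.sin ν * h1 - Real.sin μ * h2
  simp [h3]
end

section
/- Let Pe > 0 and let μ > 0 satisfy the eigenvalue equation cos μ = −(Pe/2)·(sin μ)/μ. Then the normalization integral of the eigenfunction is ∫₀¹ sin²(μ(1 − ξ)) dξ = 1/2 + (Pe/4)·((sin μ)/μ)². -/
open Real Set

/-- Normalization integral of an eigenfunction:
`∫₀¹ sin²(μ(1-ξ)) dξ = 1/2 + (Pe/4)·((sin μ)/μ)²`. -/
theorem eigenfunction_normalization (Pe μ : ℝ) (hPe : 0 < Pe) (hμ : 0 < μ)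
    (heig : Real.cos μ = -(Pe / 2) * (Real.sin μ / μ)) :
    ∫ ξ in (0:ℝ)..1, Real.sin (μ * (1 - ξ)) ^ 2 =
      1 / 2 + (Pe / 4) * (Real.sin μ / μ) ^ 2 := by
  have h1 : ∫ ξ in (0:ℝ)..1, Real.sin (μ * (1 - ξ)) ^ 2 =
      ∫ ξ in (0:ℝ)..1, Real.sin (μ - μ * ξ) ^ 2 := by
    congr 1
    funext ξ
    rw [mul_sub, mul_one]
  rw [h1, intervalIntegral.integral_comp_sub_mul (fun x => Real.sin x ^ 2) hμ.ne' μ,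
    integral_sin_sq]
  simp only [mul_one, mul_zero, sub_self, sub_zero, Real.sin_zero, Real.cos_zero, smul_eq_mul,
    heig]
  field_simp
  ring
end

section
/- Define J₂ : (0, ∞) → ℝ by J₂(τ) = π·(e^{−(π²/4)τ} − 3·e^{−(9π²/4)τ}) (the two-term approximation of the normalized exit flow at Pe = 0 and zero reaction). Then for τ > 0 the derivative J₂′(τ) vanishes if and only if τ = τ* := 3·ln 3/(2π²); moreover J₂(τ*) = (8π/9)·3^{−3/8}, so that the peak number satisfies τ*·J₂(τ*) = (4·ln 3/(3π))·3^{−3/8} ≈ 0.309. -/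
open Real

/-- For the two-term approximation `J₂(τ) = π(e^{-(π²/4)τ} - 3e^{-(9π²/4)τ})` of the normalized
exit flow at Pe = 0 and zero reaction: for τ > 0, `J₂'(τ) = 0` iff `τ = τ* = 3 ln 3/(2π²)`;
moreover `J₂(τ*) = (8π/9)·3^{-3/8}`, so the peak number is
`τ*·J₂(τ*) = (4 ln 3/(3π))·3^{-3/8} ≈ 0.309`. -/
theorem two_term_peak_number (J : ℝ → ℝ)
    (hJ : ∀ τ, J τ = π * (Real.exp (-(π ^ 2 / 4) * τ) - 3 * Real.exp (-(9 * π ^ 2 / 4) * τ))) :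
    (∀ τ : ℝ, 0 < τ → (deriv J τ = 0 ↔ τ = 3 * Real.log 3 / (2 * π ^ 2))) ∧
    J (3 * Real.log 3 / (2 * π ^ 2)) = (8 * π / 9) * (3 : ℝ) ^ (-(3 : ℝ) / 8) ∧
    (3 * Real.log 3 / (2 * π ^ 2)) * J (3 * Real.log 3 / (2 * π ^ 2)) =
      (4 * Real.log 3 / (3 * π)) * (3 : ℝ) ^ (-(3 : ℝ) / 8) ∧
    |(4 * Real.log 3 / (3 * π)) * (3 : ℝ) ^ (-(3 : ℝ) / 8) - 0.309| < 0.001 := by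
  have hpi := Real.pi_pos
  have hpi0 : π ≠ 0 := hpi.ne'
  have hval : J (3 * Real.log 3 / (2 * π ^ 2)) = (8 * π / 9) * (3 : ℝ) ^ (-(3 : ℝ) / 8) := by
    have e1 : -(π ^ 2 / 4) * (3 * Real.log 3 / (2 * π ^ 2)) = Real.log 3 * (-(3 : ℝ) / 8) := by
      field_simp
      ring
    have e2 : -(9 * π ^ 2 / 4) * (3 * Real.log 3 / (2 * π ^ 2)) =
        Real.log 3 * (-(3 : ℝ) / 8) - (3 : ℕ) * Real.log 3 := by
      push_cast
      field_simp
      ring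
    rw [hJ, e1, e2, Real.exp_sub, Real.exp_nat_mul, Real.exp_log (by norm_num),
      Real.rpow_def_of_pos (by norm_num)]
    ring
  refine ⟨?_, hval, ?_, ?_⟩
  · intro τ _
    have hd : HasDerivAt J (π * (Real.exp (-(π ^ 2 / 4) * τ) * (-(π ^ 2 / 4) * 1) -
        3 * (Real.exp (-(9 * π ^ 2 / 4) * τ) * (-(9 * π ^ 2 / 4) * 1)))) τ := by
      rw [funext hJ]
      exact ((((hasDerivAt_id τ).const_mul _).exp).sub
        ((((hasDerivAt_id τ).const_mul _).exp).const_mul 3)).const_mul π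
    rw [hd.deriv]
    have h27 : Real.exp (-(9 * π ^ 2 / 4) * τ + 3 * Real.log 3) =
        27 * Real.exp (-(9 * π ^ 2 / 4) * τ) := by
      have : (3 : ℝ) * Real.log 3 = (3 : ℕ) * Real.log 3 := by norm_num
      rw [Real.exp_add, this, Real.exp_nat_mul, Real.exp_log (by norm_num)]
      ring
    have h1 : π * (Real.exp (-(π ^ 2 / 4) * τ) * (-(π ^ 2 / 4) * 1) -
        3 * (Real.exp (-(9 * π ^ 2 / 4) * τ) * (-(9 * π ^ 2 / 4) * 1))) =
        -(π ^ 3 / 4) * (Real.exp (-(π ^ 2 / 4) * τ) -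
          Real.exp (-(9 * π ^ 2 / 4) * τ + 3 * Real.log 3)) := by
      rw [h27]
      ring
    have h2 : -(π ^ 3 / 4) ≠ 0 := by
      have : 0 < π ^ 3 / 4 := by positivity
      linarith
    rw [h1, mul_eq_zero, or_iff_right h2, sub_eq_zero, Real.exp_eq_exp,
      eq_div_iff (by positivity)]
    constructor <;> intro h <;> linarith
  · rw [hval]
    field_simp
    ring
  · set y : ℝ := (3 : ℝ) ^ (-(3 : ℝ) / 8) with hy
    have hy0 : 0 < y := by positivity
    have hy8 : y ^ 8 = 1 / 27 := by
      rw [hy, ← Real.rpow_natCast, ← Real.rpow_mul (by norm_num)]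
      norm_num
    have hl : 0.662 < y := by
      apply lt_of_pow_lt_pow_left₀ 8 hy0.le
      rw [hy8]
      norm_num
    have hu : y < 0.663 := by
      apply lt_of_pow_lt_pow_left₀ 8 (by norm_num)
      rw [hy8]
      norm_num
    have l1 := Real.log_three_gt_d9
    have l2 := Real.log_three_lt_d9
    have p1 := Real.pi_gt_d4
    have p2 := Real.pi_lt_d4
    have m1 : 1.0986 * 0.662 < Real.log 3 * y := by
      apply mul_lt_mul'' <;> linarith
    have m2 : Real.log 3 * y < 1.0987 * 0.663 := by
      apply mul_lt_mul'' <;> linarith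
    have e : 4 * Real.log 3 / (3 * π) * y = 4 * (Real.log 3 * y) / (3 * π) := by ring
    rw [e, abs_lt]
    constructor
    · rw [lt_sub_iff_add_lt, lt_div_iff₀ (by positivity)]
      norm_num at *
      linarith
    · rw [sub_lt_iff_lt_add, div_lt_iff₀ (by positivity)]
      norm_num at *
      linarith
end
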